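/- Suppose p ∈ (0,1] and q ∈ [0,1) satisfy max{p, 1−q} ≥ θ/n for a constant θ > 0. Consider a random matching algorithm on an edge-Markovian evolving graph with parameters p, q whose matching distributions satisfy the F-fair condition for some 0 < F ≤ 1. Then there exists a constant c > 0 (depending only on θ; one may take c = 91/c_*) such that for any initial configuration Γ_0 and any ε with 0 < ε < 1/4, Pr[ T_bal ≤ (c·r/F)·log(Δ·n/ε) ] ≥ 1 − ε. -/

import Mathlib

open Finset

noncomputable section

/-- Rounding a real number to the nearest integer, ties rounded up: `⌈x⌋ := ⌈x - 1/2⌉`. -/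
def roundNear (x : ℝ) : ℤ := ⌈x - 1 / 2⌉

/-- The degree of a vertex in a simple graph (stated without decidability assumptions). -/
def gdeg {V : Type} (G : SimpleGraph V) (v : V) : ℕ := Nat.card {u : V // G.Adj v u}

/-- The initial discrepancy `Δ = max Γ₀ - min Γ₀` of a load configuration. -/
def disc {V : Type} [Fintype V] [Nonempty V] (Γ₀ : V → ℕ) : ℕ :=
  Finset.univ.sup Γ₀ - Finset.univ.inf' Finset.univ_nonempty Γ₀

/-- An execution of a random matching load-balancing algorithm on an edge-Markovian
evolving graph with parameters `p, q` on the vertex set `V`: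
* `G t` is the (random) graph at time `t`, `M t` the random matching chosen at time `t`,
  and `Γ t` the load configuration at time `t`;
* `hist t` is the σ-algebra of events determined by the history
  `Γ_0, G_0, M_0, Γ_1, …, G_{t-1}, M_{t-1}, Γ_t` of the execution up to time `t`;
* conditionally on any (positive-probability) event determined by the history up to time `t+1`
  which determines `G t = H`, every non-edge of `H` becomes an edge of `G (t+1)` with
  probability `p`, every edge of `H` disappears with probability `q`, independently over pairs;
* for every matched pair `{v,u}` of `M t`, the loads are rebalanced to
  `(⌈(Γ t v + Γ t u)/2⌉, ⌊(Γ t v + Γ t u)/2⌋)` or the transposed pair (each with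
  probability `1/2`, which only matters when `Γ t v + Γ t u` is odd), while
  unmatched vertices keep their loads. -/
structure EMLoadProcess (V : Type) [Fintype V] [DecidableEq V] where
  Ω : Type
  [mΩ : MeasurableSpace Ω]
  μ : MeasureTheory.Measure Ω
  isProb : MeasureTheory.IsProbabilityMeasure μ
  p : ℝ
  q : ℝ
  p_pos : 0 < p
  p_le_one : p ≤ 1
  q_nonneg : 0 ≤ q
  q_lt_one : q < 1
  G : ℕ → Ω → SimpleGraph V
  M : ℕ → Ω → Set (Sym2 V)
  Γ : ℕ → Ω → V → ℕ
  hist : ℕ → MeasurableSpace Ω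
  hist_le : ∀ t, hist t ≤ mΩ
  hist_mono : Monotone hist
  meas_Γ : ∀ t, @Measurable Ω (V → ℕ) (hist t) ⊤ (Γ t)
  meas_G : ∀ t, @Measurable Ω (SimpleGraph V) (hist (t + 1)) ⊤ (G t)
  meas_M : ∀ t, @Measurable Ω (Set (Sym2 V)) (hist (t + 1)) ⊤ (M t)
  M_sub : ∀ t ω, M t ω ⊆ (G t ω).edgeSet
  M_matching : ∀ t ω, ∀ e ∈ M t ω, ∀ f ∈ M t ω, ∀ x : V, x ∈ e → x ∈ f → e = f
  unmatched : ∀ t ω v, (∀ u : V, s(v, u) ∉ M t ω) → Γ (t + 1) ω v = Γ t ω v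
  matched : ∀ t ω v u, s(v, u) ∈ M t ω →
    (Γ (t + 1) ω v = (Γ t ω v + Γ t ω u + 1) / 2 ∧ Γ (t + 1) ω u = (Γ t ω v + Γ t ω u) / 2) ∨
    (Γ (t + 1) ω v = (Γ t ω v + Γ t ω u) / 2 ∧ Γ (t + 1) ω u = (Γ t ω v + Γ t ω u + 1) / 2)
  coin : ∀ (t : ℕ) (v u : V) (E : Set Ω),
    @MeasurableSet _ (hist t ⊔ MeasurableSpace.comap (G t) ⊤ ⊔ MeasurableSpace.comap (M t) ⊤) E →
    μ E ≠ 0 → E ⊆ {ω | s(v, u) ∈ M t ω ∧ Odd (Γ t ω v + Γ t ω u)} →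
    ProbabilityTheory.cond μ E {ω | Γ (t + 1) ω v = (Γ t ω v + Γ t ω u + 1) / 2} = 1 / 2
  markov_edge : ∀ (t : ℕ) (H : SimpleGraph V) (E : Set Ω), @MeasurableSet _ (hist (t + 1)) E →
    μ E ≠ 0 → E ⊆ {ω | G t ω = H} → ∀ e : Sym2 V, ¬e.IsDiag → e ∈ H.edgeSet →
    ProbabilityTheory.cond μ E {ω | e ∈ (G (t + 1) ω).edgeSet} = ENNReal.ofReal (1 - q)
  markov_nonedge : ∀ (t : ℕ) (H : SimpleGraph V) (E : Set Ω), @MeasurableSet _ (hist (t + 1)) E →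
    μ E ≠ 0 → E ⊆ {ω | G t ω = H} → ∀ e : Sym2 V, ¬e.IsDiag → e ∉ H.edgeSet →
    ProbabilityTheory.cond μ E {ω | e ∈ (G (t + 1) ω).edgeSet} = ENNReal.ofReal p
  markov_indep : ∀ (t : ℕ) (H : SimpleGraph V) (E : Set Ω), @MeasurableSet _ (hist (t + 1)) E →
    μ E ≠ 0 → E ⊆ {ω | G t ω = H} →
    ProbabilityTheory.iIndepSet (fun e : {e : Sym2 V // ¬e.IsDiag} => {ω | (e : Sym2 V) ∈ (G (t + 1) ω).edgeSet})
      (ProbabilityTheory.cond μ E)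

/-- The `F`-fair condition: conditionally on `G t = Gr` and any (positive-probability) event
determined by the history of the execution up to time `t`, every edge `{u,v}` of `Gr` is matched
with probability at least `F / max (deg u) (deg v)`. -/
def EMLoadProcess.Fair {V : Type} [Fintype V] [DecidableEq V]
    (P : EMLoadProcess V) (F : ℝ) : Prop :=
  ∀ (t : ℕ) (Gr : SimpleGraph V) (u v : V), Gr.Adj u v →
    ∀ E : Set P.Ω, @MeasurableSet _ (P.hist t) E →
      P.μ ({ω | P.G t ω = Gr} ∩ E) ≠ 0 →
      ENNReal.ofReal (F / (max (gdeg Gr u) (gdeg Gr v) : ℝ)) ≤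
        ProbabilityTheory.cond P.μ ({ω | P.G t ω = Gr} ∩ E) {ω | s(u, v) ∈ P.M t ω}

/-- The ratio `r := max{p/(1−q), (1−q)/p}` of an edge-Markovian evolving graph. -/
def EMLoadProcess.r {V : Type} [Fintype V] [DecidableEq V] (P : EMLoadProcess V) : ℝ :=
  max (P.p / (1 - P.q)) ((1 - P.q) / P.p)

/-- The average load `μ = (Σ_v Γ₀(v))/n` of a configuration `Γ₀`. -/
def avgLoad {V : Type} [Fintype V] (Γ₀ : V → ℕ) : ℝ :=
  (∑ v : V, (Γ₀ v : ℝ)) / (Fintype.card V : ℝ)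

/-- The drop of `f a + f b` when the integer loads `a` and `b` are balanced. -/
def balDrop (f : ℤ → ℤ) (a b : ℤ) : ℤ := f a + f b - f ((a + b + 1) / 2) - f ((a + b) / 2)

/-- The square of the amount by which `|z|` exceeds one. -/
def excessSq (z : ℤ) : ℤ := max (|z| - 1) 0 ^ 2

lemma balDrop_comm (f : ℤ → ℤ) (a b : ℤ) : balDrop f a b = balDrop f b a := by
  unfold balDrop
  rw [add_comm b a]
  ring

lemma balDrop_self (f : ℤ → ℤ) (a : ℤ) : balDrop f a a = 0 := by
  unfold balDrop
  rw [show (a + a + 1) / 2 = a by omega, show (a + a) / 2 = a by omega]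
  ring

lemma balDrop_sq_nonneg (a b : ℤ) : 0 ≤ balDrop (fun z => z ^ 2) a b := by
  unfold balDrop
  obtain ⟨k, hk | hk⟩ := Int.even_or_odd' (a + b)
  · rw [show (a + b + 1) / 2 = k by omega, show (a + b) / 2 = k by omega]
    obtain rfl : b = 2 * k - a := by omega
    nlinarith [sq_nonneg (a - k)]
  · rw [show (a + b + 1) / 2 = k + 1 by omega, show (a + b) / 2 = k by omega]
    obtain rfl : b = 2 * k + 1 - a := by omega
    have : 0 ≤ (a - k) * (a - k - 1) := by
      rcases le_or_gt a k with h | h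
      · nlinarith
      · exact mul_nonneg (by omega) (by omega)
    nlinarith

lemma sq_sub_one_le_two_mul_balDrop_sq (a b : ℤ) :
    (a - b) ^ 2 - 1 ≤ 2 * balDrop (fun z => z ^ 2) a b := by
  unfold balDrop
  obtain ⟨k, hk | hk⟩ := Int.even_or_odd' (a + b)
  · rw [show (a + b + 1) / 2 = k by omega, show (a + b) / 2 = k by omega]
    obtain rfl : b = 2 * k - a := by omega
    nlinarith
  · rw [show (a + b + 1) / 2 = k + 1 by omega, show (a + b) / 2 = k by omega]
    obtain rfl : b = 2 * k + 1 - a := by omega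
    nlinarith

lemma excessSq_nonneg (z : ℤ) : 0 ≤ excessSq z := sq_nonneg _

lemma excessSq_neg (z : ℤ) : excessSq (-z) = excessSq z := by simp [excessSq]

lemma excessSq_of_one_le {z : ℤ} (h : 1 ≤ z) : excessSq z = (z - 1) ^ 2 := by
  rw [excessSq, abs_of_pos (by omega), max_eq_left (by omega)]

lemma excessSq_of_le_neg_one {z : ℤ} (h : z ≤ -1) : excessSq z = (z + 1) ^ 2 := by
  rw [← excessSq_neg, excessSq_of_one_le (by omega)]
  ring

lemma excessSq_zero : excessSq 0 = 0 := by simp [excessSq]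

lemma excessSq_le_sq (z : ℤ) : excessSq z ≤ z ^ 2 := by
  rcases lt_trichotomy z 0 with h | rfl | h
  · rw [excessSq_of_le_neg_one (by omega)]
    nlinarith
  · simp [excessSq]
  · rw [excessSq_of_one_le (by omega)]
    nlinarith

lemma one_le_excessSq {z : ℤ} (h : 1 < |z|) : 1 ≤ excessSq z := by
  rw [excessSq, max_eq_left (by omega)]
  nlinarith

lemma excessSq_subgradient (k x : ℤ) :
    excessSq k + (excessSq (k + 1) - excessSq k) * (x - k) ≤ excessSq x := by
  have hx := excessSq_nonneg x
  rcases lt_trichotomy k 0 with h | rfl | h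
  · rw [excessSq_of_le_neg_one (z := k) (by omega)]
    rcases eq_or_lt_of_le (show k ≤ -1 by omega) with rfl | h'
    · simp [excessSq_zero, hx]
    rw [excessSq_of_le_neg_one (z := k + 1) (by omega)]
    rcases lt_or_ge x 0 with h2 | h2
    · rw [excessSq_of_le_neg_one (by omega)]
      have : 0 ≤ (x - k) * (x - k - 1) := by
        rcases le_or_gt x k with h | h
        · nlinarith
        · exact mul_nonneg (by omega) (by omega)
      nlinarith
    · nlinarith
  · simp [excessSq_zero, excessSq_of_one_le (le_refl 1), hx]
  · rw [excessSq_of_one_le (z := k) (by omega), excessSq_of_one_le (z := k + 1) (by omega)]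
    rcases le_or_gt x 0 with h2 | h2
    · nlinarith
    · rw [excessSq_of_one_le (by omega)]
      have : 0 ≤ (x - k) * (x - k - 1) := by
        rcases le_or_gt x k with h | h
        · nlinarith
        · exact mul_nonneg (by omega) (by omega)
      nlinarith

lemma balDrop_excessSq_nonneg (a b : ℤ) : 0 ≤ balDrop excessSq a b := by
  unfold balDrop
  obtain ⟨k, hk | hk⟩ := Int.even_or_odd' (a + b)
  · rw [show (a + b + 1) / 2 = k by omega, show (a + b) / 2 = k by omega]
    have h1 := excessSq_subgradient k a
    have h2 := excessSq_subgradient k b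
    obtain rfl : b = 2 * k - a := by omega
    nlinarith
  · rw [show (a + b + 1) / 2 = k + 1 by omega, show (a + b) / 2 = k by omega]
    have h1 := excessSq_subgradient k a
    have h2 := excessSq_subgradient k b
    obtain rfl : b = 2 * k + 1 - a := by omega
    nlinarith

lemma balDrop_excessSq_neg (a b : ℤ) :
    balDrop excessSq (-a) (-b) = balDrop excessSq a b := by
  unfold balDrop
  rw [show (-a + -b + 1) / 2 = -((a + b) / 2) by omega,
    show (-a + -b) / 2 = -((a + b + 1) / 2) by omega]
  simp only [excessSq_neg]
  ring

lemma excessSq_half_add_le {a b : ℤ} (ha : 0 < a) (hb : b ≤ 0) (hab : 0 ≤ a + b) :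
    2 * (excessSq ((a + b + 1) / 2) + excessSq ((a + b) / 2)) ≤ excessSq a := by
  rw [excessSq_of_one_le (z := a) (by omega)]
  obtain ⟨k, hk | hk⟩ := Int.even_or_odd' (a + b)
  · rw [show (a + b + 1) / 2 = k by omega, show (a + b) / 2 = k by omega]
    rcases eq_or_lt_of_le (show 0 ≤ k by omega) with rfl | h
    · simp [excessSq_zero, sq_nonneg]
    · rw [excessSq_of_one_le (by omega)]
      nlinarith
  · rw [show (a + b + 1) / 2 = k + 1 by omega, show (a + b) / 2 = k by omega]
    rcases eq_or_lt_of_le (show 0 ≤ k by omega) with rfl | h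
    · simp [excessSq_zero, excessSq_of_one_le (le_refl 1), sq_nonneg]
    · rw [excessSq_of_one_le (by omega), excessSq_of_one_le (by omega)]
      nlinarith

lemma le_two_mul_balDrop_excessSq {a b : ℤ} (ha : 0 ≤ a) (hb : b ≤ 0) :
    excessSq a + excessSq b ≤ 2 * balDrop excessSq a b := by
  rcases eq_or_lt_of_le ha with rfl | ha'
  · rcases eq_or_lt_of_le hb with rfl | hb'
    · simp [balDrop, excessSq_zero]
    · have := excessSq_half_add_le (a := -b) (b := -0) (by omega) (by omega) (by omega)
      have h2 := balDrop_excessSq_neg b 0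
      rw [balDrop_comm _ 0 b, ← h2]
      rw [excessSq_neg] at this
      have h3 := excessSq_neg b
      simp only [balDrop, excessSq_zero, neg_zero] at this ⊢
      linarith
  rcases le_or_gt 0 (a + b) with h | h
  · have := excessSq_half_add_le ha' hb h
    have := excessSq_nonneg b
    unfold balDrop
    linarith
  · have := excessSq_half_add_le (a := -b) (b := -a) (by omega) (by omega) (by omega)
    have h2 := balDrop_excessSq_neg b a
    rw [balDrop_comm _ a b, ← h2]
    have h3 := excessSq_neg b
    have h4 := excessSq_neg a
    have h5 := excessSq_nonneg a
    unfold balDrop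
    linarith

/-- The share of the drop of the excess potential charged to the load `a` when it meets `b`. -/
def charge (a b : ℤ) : ℤ := if (0 < a ∧ b ≤ 0) ∨ (a < 0 ∧ 0 ≤ b) then excessSq a else 0

lemma charge_le (a b : ℤ) : charge a b ≤ excessSq a := by
  unfold charge
  split_ifs
  · exact le_rfl
  · exact excessSq_nonneg a

lemma charge_add_charge_le (a b : ℤ) :
    charge a b + charge b a ≤ 2 * balDrop excessSq a b := by
  by_cases h : (0 ≤ a ∧ b ≤ 0) ∨ (a ≤ 0 ∧ 0 ≤ b)
  · have h1 := charge_le a b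
    have h2 := charge_le b a
    rcases h with h | h
    · linarith [le_two_mul_balDrop_excessSq h.1 h.2]
    · rw [balDrop_comm]
      linarith [le_two_mul_balDrop_excessSq h.2 h.1]
  · have h1 : charge a b = 0 := if_neg (by omega)
    have h2 : charge b a = 0 := if_neg (by omega)
    linarith [balDrop_excessSq_nonneg a b]

lemma le_charge_of_pos {a : ℤ} (ha : 0 < a) (b : ℤ) :
    excessSq a * (8 - 6 * b - 2 * b ^ 2) ≤ 12 * charge a b := by
  have hg := excessSq_nonneg a
  rcases le_or_gt b 0 with h | h
  · rw [charge, if_pos (by omega)]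
    have : 0 ≤ (b + 1) * (b + 2) := by
      rcases le_or_gt b (-2) with h | h
      · nlinarith
      · exact mul_nonneg (by omega) (by omega)
    nlinarith
  · rw [charge, if_neg (by omega)]
    have : 8 - 6 * b - 2 * b ^ 2 ≤ 0 := by nlinarith
    nlinarith

lemma le_charge_of_neg {a : ℤ} (ha : a < 0) (b : ℤ) :
    excessSq a * (8 + 6 * b - 2 * b ^ 2) ≤ 12 * charge a b := by
  have h := le_charge_of_pos (a := -a) (by omega) (-b)
  have hc : charge (-a) (-b) = charge a b := by
    simp only [charge, excessSq_neg]
    congr 1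
    apply propext
    omega
  rw [hc, excessSq_neg] at h
  linarith

section Potential
variable {V : Type} [Fintype V]

/-- The combined potential of a centred load vector. -/
def potential (z : V → ℤ) : ℤ :=
  (if (Fintype.card V : ℤ) ≤ ∑ v, z v ^ 2 then ∑ v, z v ^ 2 else 0) + ∑ v, excessSq (z v)

/-- The drop of the relevant part of the potential when `u` and `v` are matched. -/
def potentialDrop (z : V → ℤ) (u v : V) : ℤ :=
  if (Fintype.card V : ℤ) ≤ ∑ v, z v ^ 2 then balDrop (fun x => x ^ 2) (z u) (z v)
  else balDrop excessSq (z u) (z v)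

lemma potentialDrop_nonneg (z : V → ℤ) (u v : V) : 0 ≤ potentialDrop z u v := by
  unfold potentialDrop
  split_ifs
  · exact balDrop_sq_nonneg _ _
  · exact balDrop_excessSq_nonneg _ _

lemma potentialDrop_self (z : V → ℤ) (u : V) : potentialDrop z u u = 0 := by
  simp [potentialDrop, balDrop_self]

lemma potential_nonneg (z : V → ℤ) : 0 ≤ potential z := by
  unfold potential
  have h1 : 0 ≤ ∑ v, z v ^ 2 := sum_nonneg fun v _ => sq_nonneg _
  have h2 : 0 ≤ ∑ v, excessSq (z v) := sum_nonneg fun v _ => excessSq_nonneg _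
  split_ifs <;> linarith

lemma potential_le (z : V → ℤ) : potential z ≤ 2 * ∑ v, z v ^ 2 := by
  unfold potential
  have h1 : 0 ≤ ∑ v, z v ^ 2 := sum_nonneg fun v _ => sq_nonneg _
  have h2 : ∑ v, excessSq (z v) ≤ ∑ v, z v ^ 2 := sum_le_sum fun v _ => excessSq_le_sq _
  split_ifs <;> linarith

lemma one_le_potential {z : V → ℤ} {v : V} (h : 1 < |z v|) : 1 ≤ potential z := by
  have h1 : 0 ≤ ∑ v, z v ^ 2 := sum_nonneg fun v _ => sq_nonneg _
  have h2 : excessSq (z v) ≤ ∑ v, excessSq (z v) :=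
    single_le_sum (f := fun v => excessSq (z v)) (fun v _ => excessSq_nonneg _) (mem_univ v)
  have h3 := one_le_excessSq h
  unfold potential
  split_ifs <;> linarith

lemma card_mul_potential_le (z : V → ℤ) (hz : 2 * |∑ v, z v| ≤ Fintype.card V) :
    (Fintype.card V : ℤ) * potential z ≤ 8 * ∑ u, ∑ v, potentialDrop z u v := by
  set n : ℤ := (Fintype.card V : ℤ) with hn
  set S : ℤ := ∑ v, z v ^ 2 with hS
  have hn0 : 0 ≤ n := by positivity
  have hb := abs_le.1 (le_refl |∑ v, z v|)
  by_cases h : n ≤ S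
  · have h1 := potential_le z
    have h2 : ∑ u, ∑ v, ((z u - z v) ^ 2 - 1) ≤ ∑ u, ∑ v, 2 * potentialDrop z u v := by
      refine sum_le_sum fun u _ => sum_le_sum fun v _ => ?_
      rw [potentialDrop, if_pos h]
      exact sq_sub_one_le_two_mul_balDrop_sq _ _
    have h3 : ∑ u, ∑ v, ((z u - z v) ^ 2 - 1) = 2 * n * S - 2 * (∑ v, z v) ^ 2 - n ^ 2 := by
      simp only [sub_sq, sum_sub_distrib, sum_add_distrib, sum_const, card_univ, nsmul_eq_mul,
        ← mul_sum, ← sum_mul, mul_assoc, ← hn, ← hS]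
      ring
    have h4 : 4 * (∑ v, z v) ^ 2 ≤ n ^ 2 := by
      rw [← sq_abs]
      nlinarith [abs_nonneg (∑ v, z v)]
    simp only [← mul_sum] at h2
    rw [h3] at h2
    nlinarith
  · have hp : potential z = ∑ v, excessSq (z v) := by rw [potential, if_neg h, zero_add]
    have h1 : ∑ u, ∑ v, (charge (z u) (z v) + charge (z v) (z u))
        ≤ ∑ u, ∑ v, 2 * potentialDrop z u v := by
      refine sum_le_sum fun u _ => sum_le_sum fun v _ => ?_
      rw [potentialDrop, if_neg h]
      exact charge_add_charge_le _ _
    have h2 : ∑ u, 3 * n * excessSq (z u) ≤ ∑ u, 12 * ∑ v, charge (z u) (z v) := by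
      refine sum_le_sum fun u _ => ?_
      have hg := excessSq_nonneg (z u)
      rw [mul_sum]
      rcases lt_trichotomy (z u) 0 with hu | hu | hu
      · refine le_trans ?_ (sum_le_sum fun v _ => le_charge_of_neg hu (z v))
        simp only [← mul_sum, sum_sub_distrib, sum_add_distrib, sum_const, card_univ,
          nsmul_eq_mul, ← hn, ← hS]
        nlinarith
      · simp [hu, excessSq_zero, charge]
      · refine le_trans ?_ (sum_le_sum fun v _ => le_charge_of_pos hu (z v))
        simp only [← mul_sum, sum_sub_distrib, sum_const, card_univ,
          nsmul_eq_mul, ← hn, ← hS]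
        nlinarith
    have h3 : ∑ u, ∑ v, charge (z v) (z u) = ∑ u, ∑ v, charge (z u) (z v) := sum_comm
    simp only [sum_add_distrib, ← mul_sum] at h1 h2
    rw [h3] at h1
    have hp0 := potential_nonneg z
    rw [hp] at hp0 ⊢
    nlinarith

/-- Balancing along the matching `M` turns the loads `z` into `z'`. -/
structure BalanceStep (M : Set (Sym2 V)) (z z' : V → ℤ) : Prop where
  matching : ∀ e ∈ M, ∀ f ∈ M, ∀ x : V, x ∈ e → x ∈ f → e = f
  unmatched : ∀ v, (∀ u : V, s(v, u) ∉ M) → z' v = z v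
  matched : ∀ v u, s(v, u) ∈ M →
    (z' v = (z v + z u + 1) / 2 ∧ z' u = (z v + z u) / 2) ∨
    (z' v = (z v + z u) / 2 ∧ z' u = (z v + z u + 1) / 2)

open Classical in
lemma BalanceStep.sum_balDrop {M : Set (Sym2 V)} {z z' : V → ℤ} (h : BalanceStep M z z')
    (f : ℤ → ℤ) :
    ∑ u, ∑ v, (if s(u, v) ∈ M then balDrop f (z u) (z v) else 0)
      = 2 * (∑ v, f (z v) - ∑ v, f (z' v)) := by
  have h1 : ∑ u, ∑ v, (if s(u, v) ∈ M then f (z u) - f (z' u) else 0)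
      = ∑ v, f (z v) - ∑ v, f (z' v) := by
    rw [← sum_sub_distrib]
    refine sum_congr rfl fun u _ => ?_
    by_cases hu : ∃ v, s(u, v) ∈ M
    · obtain ⟨v, hv⟩ := hu
      rw [sum_eq_single v, if_pos hv]
      · intro w _ hw
        refine if_neg fun hwM => hw ?_
        have := h.matching _ hwM _ hv u (by simp) (by simp)
        rcases Sym2.eq_iff.1 this with ⟨-, h⟩ | ⟨h1, h2⟩
        · exact h
        · exact h2.trans h1
      · simp
    · push Not at hu
      simp [hu, h.unmatched u hu]
  have h2 : ∑ u, ∑ v, (if s(u, v) ∈ M then f (z v) - f (z' v) else 0)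
      = ∑ v, f (z v) - ∑ v, f (z' v) := by
    rw [← h1, sum_comm]
    simp only [Sym2.eq_swap]
  rw [two_mul]
  nth_rewrite 1 [← h1]
  rw [← h2, ← sum_add_distrib]
  refine sum_congr rfl fun u _ => ?_
  rw [← sum_add_distrib]
  refine sum_congr rfl fun v _ => ?_
  split_ifs with hM
  · rcases h.matched u v hM with ⟨h3, h4⟩ | ⟨h3, h4⟩ <;> rw [h3, h4, balDrop] <;> ring
  · simp

lemma BalanceStep.sum_le {M : Set (Sym2 V)} {z z' : V → ℤ} (h : BalanceStep M z z')
    {f : ℤ → ℤ} (hf : ∀ a b, 0 ≤ balDrop f a b) : ∑ v, f (z' v) ≤ ∑ v, f (z v) := by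
  classical
  have h1 := h.sum_balDrop f
  have h2 : 0 ≤ ∑ u, ∑ v, (if s(u, v) ∈ M then balDrop f (z u) (z v) else 0) :=
    sum_nonneg fun u _ => sum_nonneg fun v _ => by split_ifs <;> simp [hf]
  linarith

lemma BalanceStep.sum_eq {M : Set (Sym2 V)} {z z' : V → ℤ} (h : BalanceStep M z z') :
    ∑ v, z' v = ∑ v, z v := by
  classical
  have h1 := h.sum_balDrop (fun x => x)
  have h2 : ∀ a b : ℤ, balDrop (fun x => x) a b = 0 := fun a b => by
    simp only [balDrop]
    omega
  simp only [h2, ite_self, sum_const_zero] at h1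
  linarith

open Classical in
lemma BalanceStep.potential_add_le {M : Set (Sym2 V)} {z z' : V → ℤ} (h : BalanceStep M z z') :
    2 * potential z' + ∑ u, ∑ v, (if s(u, v) ∈ M then potentialDrop z u v else 0)
      ≤ 2 * potential z := by
  have hS := h.sum_le balDrop_sq_nonneg
  have hG := h.sum_le balDrop_excessSq_nonneg
  have hS0 : 0 ≤ ∑ v, z' v ^ 2 := sum_nonneg fun v _ => sq_nonneg _
  by_cases hn : (Fintype.card V : ℤ) ≤ ∑ v, z v ^ 2
  · have := h.sum_balDrop (fun x => x ^ 2)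
    simp only [potential, potentialDrop, if_pos hn]
    split_ifs <;> linarith
  · have := h.sum_balDrop excessSq
    have hn' : ¬ (Fintype.card V : ℤ) ≤ ∑ v, z' v ^ 2 := fun h' => hn (h'.trans hS)
    simp only [potential, potentialDrop, if_neg hn, if_neg hn']
    linarith

lemma BalanceStep.potential_le {M : Set (Sym2 V)} {z z' : V → ℤ} (h : BalanceStep M z z') :
    potential z' ≤ potential z := by
  classical
  have h1 := h.potential_add_le
  have h2 : 0 ≤ ∑ u, ∑ v, (if s(u, v) ∈ M then potentialDrop z u v else 0) :=
    sum_nonneg fun u _ => sum_nonneg fun v _ => by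
      split_ifs <;> simp [potentialDrop_nonneg]
  linarith

end Potential

section Execution
open MeasureTheory ProbabilityTheory
attribute [local instance] EMLoadProcess.mΩ EMLoadProcess.isProb

/-- The law of total probability over a finite-valued random variable. -/
lemma measureReal_inter_eq_sum {Ω β : Type} [MeasurableSpace Ω] [Fintype β]
    (μ : Measure Ω) [IsFiniteMeasure μ] {X : Ω → β} (hX : Measurable[_, ⊤] X) (E : Set Ω)
    (Q : β → Prop) [DecidablePred Q] :
    μ.real (E ∩ {ω | Q (X ω)}) = ∑ b, if Q b then μ.real (E ∩ {ω | X ω = b}) else 0 := by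
  have hm : ∀ s : Set β, MeasurableSet (X ⁻¹' s) := fun s => hX trivial
  rw [← sum_filter]
  have h := sum_measureReal_preimage_singleton (μ := μ.restrict E) (univ.filter Q) (f := X)
    (fun y _ => hm _)
  rw [measureReal_restrict_apply (hm _)] at h
  simp only [measureReal_restrict_apply (hm _)] at h
  rw [Set.inter_comm, show {ω | Q (X ω)} = X ⁻¹' ↑(univ.filter Q) by ext; simp, ← h]
  exact sum_congr rfl fun b _ => by rw [Set.inter_comm]; rfl

lemma max_gdeg_le {V : Type} [Fintype V] [DecidableEq V] (H : SimpleGraph V)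
    [DecidableRel H.Adj] {u v : V} (h : H.Adj u v) :
    max (gdeg H u) (gdeg H v) ≤ 1 + ∑ w ∈ univ \ {u, v},
      ((if s(u, w) ∈ H.edgeSet then 1 else 0) + (if s(v, w) ∈ H.edgeSet then 1 else 0)) := by
  have hcard : ∀ x, gdeg H x = ∑ w, if s(x, w) ∈ H.edgeSet then 1 else 0 := by
    intro x
    rw [gdeg, Nat.card_eq_fintype_card, Fintype.card_subtype, sum_boole]
    simp
  have hsplit : ∀ x, gdeg H x = (∑ w ∈ univ \ {u, v}, if s(x, w) ∈ H.edgeSet then 1 else 0)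
      + ((if s(x, u) ∈ H.edgeSet then 1 else 0) + (if s(x, v) ∈ H.edgeSet then 1 else 0)) := by
    intro x
    rw [hcard, ← sum_sdiff (subset_univ {u, v}), sum_pair h.ne]
  rw [sum_add_distrib, hsplit u, hsplit v]
  simp [h, h.symm]
  omega

lemma one_div_ge_tangent {x y m : ℝ} (hx : 0 < x) (hxy : x ≤ y) (hm : 0 < m) :
    2 / m - y / m ^ 2 ≤ 1 / x := by
  have h1 : 2 / m - x / m ^ 2 ≤ 1 / x := by
    have : 1 / x - (2 / m - x / m ^ 2) = (x - m) ^ 2 / (x * m ^ 2) := by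
      field_simp
      ring
    have : 0 ≤ (x - m) ^ 2 / (x * m ^ 2) := by positivity
    linarith
  have : x / m ^ 2 ≤ y / m ^ 2 := by gcongr
  linarith

variable {V : Type} [Fintype V] [DecidableEq V] (P : EMLoadProcess V)

namespace EMLoadProcess

/-- The smaller of the two edge probabilities. -/
def minProb : ℝ := min P.p (1 - P.q)

/-- The larger of the two edge probabilities. -/
def maxProb : ℝ := max P.p (1 - P.q)

/-- A lower bound for the probability that a given pair is matched. -/
def matchBound (F : ℝ) : ℝ := F * P.minProb / (1 + 2 * Fintype.card V * P.maxProb)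

lemma minProb_pos : 0 < P.minProb := lt_min P.p_pos (by linarith [P.q_lt_one])

lemma maxProb_pos : 0 < P.maxProb := lt_max_of_lt_left P.p_pos

lemma measurable_G (t : ℕ) : Measurable[P.mΩ, ⊤] (P.G t) :=
  (P.meas_G t).mono (P.hist_le _) le_rfl

lemma measurable_M (t : ℕ) : Measurable[P.mΩ, ⊤] (P.M t) :=
  (P.meas_M t).mono (P.hist_le _) le_rfl

lemma measurable_Γ (t : ℕ) : Measurable[P.mΩ, ⊤] (P.Γ t) :=
  (P.meas_Γ t).mono (P.hist_le _) le_rfl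

lemma edge_bounds {t : ℕ} {H : SimpleGraph V} {E : Set P.Ω}
    (hE : MeasurableSet[P.hist (t + 1)] E) (hEH : E ⊆ {ω | P.G t ω = H})
    {e : Sym2 V} (he : ¬e.IsDiag) :
    P.minProb * P.μ.real E ≤ P.μ.real (E ∩ {ω | e ∈ (P.G (t + 1) ω).edgeSet}) ∧
    P.μ.real (E ∩ {ω | e ∈ (P.G (t + 1) ω).edgeSet}) ≤ P.maxProb * P.μ.real E := by
  by_cases h0 : P.μ E = 0
  · have : P.μ (E ∩ {ω | e ∈ (P.G (t + 1) ω).edgeSet}) = 0 :=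
      measure_mono_null Set.inter_subset_left h0
    simp [measureReal_def, h0, this]
  have hmul := cond_mul_eq_inter (P.hist_le _ _ hE) {ω | e ∈ (P.G (t + 1) ω).edgeSet} P.μ
  have hreal : ∀ x : ℝ, 0 ≤ x → (P.μ[{ω | e ∈ (P.G (t + 1) ω).edgeSet} | E] = ENNReal.ofReal x) →
      P.μ.real (E ∩ {ω | e ∈ (P.G (t + 1) ω).edgeSet}) = x * P.μ.real E := by
    intro x hx h
    rw [measureReal_def, ← hmul, h, ENNReal.toReal_mul, ENNReal.toReal_ofReal hx, measureReal_def]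
  have hE0 : 0 ≤ P.μ.real E := measureReal_nonneg
  by_cases heH : e ∈ H.edgeSet
  · rw [hreal _ (by linarith [P.q_lt_one]) (P.markov_edge t H E hE h0 hEH e he heH)]
    exact ⟨mul_le_mul_of_nonneg_right (min_le_right _ _) hE0,
      mul_le_mul_of_nonneg_right (le_max_right _ _) hE0⟩
  · rw [hreal _ P.p_pos.le (P.markov_nonedge t H E hE h0 hEH e he heH)]
    exact ⟨mul_le_mul_of_nonneg_right (min_le_left _ _) hE0,
      mul_le_mul_of_nonneg_right (le_max_left _ _) hE0⟩

lemma two_edges_le {t : ℕ} {H : SimpleGraph V} {E : Set P.Ω}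
    (hE : MeasurableSet[P.hist (t + 1)] E) (hEH : E ⊆ {ω | P.G t ω = H})
    {e f : Sym2 V} (he : ¬e.IsDiag) (hf : ¬f.IsDiag) (hef : e ≠ f) :
    P.μ.real (E ∩ {ω | e ∈ (P.G (t + 1) ω).edgeSet ∧ f ∈ (P.G (t + 1) ω).edgeSet})
      ≤ P.maxProb * P.μ.real (E ∩ {ω | e ∈ (P.G (t + 1) ω).edgeSet}) := by
  by_cases h0 : P.μ E = 0
  · have h1 : ∀ s, P.μ (E ∩ s) = 0 := fun s => measure_mono_null Set.inter_subset_left h0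
    simp [measureReal_def, h1]
  have hmul := fun s => cond_mul_eq_inter (P.hist_le _ _ hE) s P.μ
  have hind := (P.markov_indep t H E hE h0 hEH).meas_biInter {⟨e, he⟩, ⟨f, hf⟩}
  rw [prod_pair (by simpa using hef)] at hind
  have hset : (⋂ i ∈ ({⟨e, he⟩, ⟨f, hf⟩} : Finset {e : Sym2 V // ¬e.IsDiag}),
      {ω | (i : Sym2 V) ∈ (P.G (t + 1) ω).edgeSet})
      = {ω | e ∈ (P.G (t + 1) ω).edgeSet ∧ f ∈ (P.G (t + 1) ω).edgeSet} := by
    ext ω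
    simp
  rw [hset] at hind
  have hf2 := (P.edge_bounds hE hEH hf).2
  have hEpos : 0 < P.μ.real E := ENNReal.toReal_pos h0 (measure_ne_top _ _)
  simp only [measureReal_def, ← hmul, hind, ENNReal.toReal_mul] at hf2 hEpos ⊢
  have h1 := le_of_mul_le_mul_right hf2 hEpos
  calc _ = (P.μ[{ω | f ∈ (P.G (t + 1) ω).edgeSet} | E]).toReal *
        ((P.μ[{ω | e ∈ (P.G (t + 1) ω).edgeSet} | E]).toReal * (P.μ E).toReal) := by ring
    _ ≤ _ := by gcongr

lemma Fair.le_measureReal {P : EMLoadProcess V} {F : ℝ} (hfair : P.Fair F) (hF : 0 ≤ F) {t : ℕ}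
    {H : SimpleGraph V} {u v : V} (huv : H.Adj u v) {E : Set P.Ω}
    (hE : MeasurableSet[P.hist t] E) :
    F / (max (gdeg H u) (gdeg H v) : ℝ) * P.μ.real (E ∩ {ω | P.G t ω = H})
      ≤ P.μ.real ((E ∩ {ω | s(u, v) ∈ P.M t ω}) ∩ {ω | P.G t ω = H}) := by
  by_cases h0 : P.μ ({ω | P.G t ω = H} ∩ E) = 0
  · rw [Set.inter_comm E, measureReal_def, h0]
    simp
  have hm : MeasurableSet ({ω | P.G t ω = H} ∩ E) :=
    (P.measurable_G t (show MeasurableSet[⊤] {H} from trivial)).inter (P.hist_le _ _ hE)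
  have h1 := hfair t H u v huv E hE h0
  have h2 := cond_mul_eq_inter hm {ω | s(u, v) ∈ P.M t ω} P.μ
  have h3 := mul_le_mul_left h1 (P.μ ({ω | P.G t ω = H} ∩ E))
  rw [h2] at h3
  have h4 := ENNReal.toReal_mono (measure_ne_top _ _) h3
  rw [ENNReal.toReal_mul, ENNReal.toReal_ofReal (by positivity)] at h4
  have hset : (E ∩ {ω | s(u, v) ∈ P.M t ω}) ∩ {ω | P.G t ω = H}
      = {ω | P.G t ω = H} ∩ E ∩ {ω | s(u, v) ∈ P.M t ω} := by
    ext ω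
    simp only [Set.mem_inter_iff, Set.mem_ofPred_eq]
    tauto
  rw [hset, Set.inter_comm E]
  exact h4

open Classical in
lemma Fair.matchBound_mul_le_of_subset {P : EMLoadProcess V} {F : ℝ} (hfair : P.Fair F)
    (hF : 0 ≤ F) {t : ℕ} {H : SimpleGraph V} {E : Set P.Ω}
    (hE : MeasurableSet[P.hist (t + 1)] E) (hEH : E ⊆ {ω | P.G t ω = H}) {u v : V} (huv : u ≠ v) :
    P.matchBound F * P.μ.real E ≤ P.μ.real (E ∩ {ω | s(u, v) ∈ P.M (t + 1) ω}) := by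
  have hb := P.maxProb_pos
  set b := P.maxProb
  set n : ℝ := (Fintype.card V : ℝ) with hn
  set m : ℝ := 1 + 2 * n * b with hm
  have hn0 : 0 ≤ n := by positivity
  have hm0 : 0 < m := by positivity
  set X := P.μ.real (E ∩ {ω | s(u, v) ∈ (P.G (t + 1) ω).edgeSet}) with hX
  have hX0 : 0 ≤ X := measureReal_nonneg
  have hXE : P.minProb * P.μ.real E ≤ X := (P.edge_bounds hE hEH (by simpa using huv)).1
  let x : SimpleGraph V → ℝ := fun K => P.μ.real (E ∩ {ω | P.G (t + 1) ω = K})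
  let i : V → V → SimpleGraph V → ℝ := fun a c K => if s(a, c) ∈ K.edgeSet then 1 else 0
  have hx0 : ∀ K, 0 ≤ x K := fun K => measureReal_nonneg
  have hXsum : X = ∑ K, i u v K * x K := by
    rw [hX, measureReal_inter_eq_sum P.μ (P.measurable_G (t + 1)) E
      (fun K => s(u, v) ∈ K.edgeSet)]
    simp [i, x]
  have htwo : ∀ a w : V, a ≠ w → s(u, v) ≠ s(a, w) → ∑ K, i u v K * i a w K * x K ≤ b * X := by
    intro a w haw hne
    have h1 := P.two_edges_le hE hEH (e := s(u, v)) (f := s(a, w)) (by simpa using huv)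
      (by simpa using haw) hne
    rw [measureReal_inter_eq_sum P.μ (P.measurable_G (t + 1)) E
      (fun K => s(u, v) ∈ K.edgeSet ∧ s(a, w) ∈ K.edgeSet)] at h1
    refine le_trans (le_of_eq (sum_congr rfl fun K _ => ?_)) h1
    by_cases h1 : K.Adj u v <;> by_cases h2 : K.Adj a w <;> simp [i, x, h1, h2]
  have hsum : ∑ K, i u v K * (1 + ∑ w ∈ univ \ {u, v}, (i u w K + i v w K)) * x K ≤ m * X := by
    have h1 : ∑ K, i u v K * (1 + ∑ w ∈ univ \ {u, v}, (i u w K + i v w K)) * x K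
        = X + ∑ w ∈ univ \ {u, v},
          (∑ K, i u v K * i u w K * x K + ∑ K, i u v K * i v w K * x K) := by
      simp only [hXsum, mul_add, add_mul, sum_add_distrib, mul_one, mul_sum, sum_mul]
      congr 2 <;> exact sum_comm
    have h2 : ∑ w ∈ univ \ {u, v},
          (∑ K, i u v K * i u w K * x K + ∑ K, i u v K * i v w K * x K)
        ≤ ∑ w ∈ univ \ {u, v}, 2 * (b * X) := by
      refine sum_le_sum fun w hw => ?_
      simp only [mem_sdiff, mem_univ, mem_insert, mem_singleton, true_and, not_or] at hw
      have h3 := htwo u w (Ne.symm hw.1) (by simp [Ne.symm hw.2, huv.symm])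
      have h4 := htwo v w (Ne.symm hw.2) (by simp [Ne.symm hw.1, huv])
      linarith
    have h3 : ((univ \ {u, v} : Finset V).card : ℝ) ≤ n := by
      rw [hn]
      exact_mod_cast card_le_univ _
    rw [sum_const, nsmul_eq_mul] at h2
    have h4 : ((univ \ {u, v} : Finset V).card : ℝ) * (2 * (b * X)) ≤ n * (2 * (b * X)) := by
      gcongr
    rw [h1, hm]
    linarith
  have hM : P.μ.real (E ∩ {ω | s(u, v) ∈ P.M (t + 1) ω})
      = ∑ K, P.μ.real ((E ∩ {ω | s(u, v) ∈ P.M (t + 1) ω}) ∩ {ω | P.G (t + 1) ω = K}) := by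
    have := measureReal_inter_eq_sum P.μ (P.measurable_G (t + 1))
      (E ∩ {ω | s(u, v) ∈ P.M (t + 1) ω}) (fun _ => True)
    simpa using this
  have hterm : ∀ K, F * (i u v K * (2 / m) * x K
      - i u v K * (1 + ∑ w ∈ univ \ {u, v}, (i u w K + i v w K)) * x K / m ^ 2)
      ≤ P.μ.real ((E ∩ {ω | s(u, v) ∈ P.M (t + 1) ω}) ∩ {ω | P.G (t + 1) ω = K}) := by
    intro K
    by_cases hK : K.Adj u v
    · refine le_trans ?_ (hfair.le_measureReal hF hK hE)
      have hpos : ∀ {a c}, K.Adj a c → 0 < gdeg K a := fun {a c} h => by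
        rw [gdeg, Nat.card_eq_fintype_card]
        exact Fintype.card_pos_iff.2 ⟨⟨c, h⟩⟩
      have hd : 0 < max (gdeg K u : ℝ) (gdeg K v : ℝ) :=
        lt_max_of_lt_left (by exact_mod_cast hpos hK)
      have hle : max (gdeg K u : ℝ) (gdeg K v : ℝ)
          ≤ 1 + ∑ w ∈ univ \ {u, v}, (i u w K + i v w K) := by
        have := max_gdeg_le K hK
        simp only [i]
        exact_mod_cast this
      have h1 := mul_le_mul_of_nonneg_right (one_div_ge_tangent hd hle hm0)
        (mul_nonneg hF (hx0 K))
      have h2 : i u v K = 1 := if_pos hK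
      rw [h2]
      calc _ = _ := by ring
        _ ≤ _ := h1
        _ = _ := by ring
    · have h2 : i u v K = 0 := if_neg hK
      rw [h2]
      simp
  calc P.matchBound F * P.μ.real E = F / m * (P.minProb * P.μ.real E) := by
        rw [matchBound]
        ring
    _ ≤ F / m * X := by gcongr
    _ = F * (2 / m * X - m * X / m ^ 2) := by
        field_simp
        ring
    _ ≤ F * (2 / m * X
        - (∑ K, i u v K * (1 + ∑ w ∈ univ \ {u, v}, (i u w K + i v w K)) * x K) / m ^ 2) := by
        gcongr
    _ = ∑ K, F * (i u v K * (2 / m) * x K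
      - i u v K * (1 + ∑ w ∈ univ \ {u, v}, (i u w K + i v w K)) * x K / m ^ 2) := by
        rw [← mul_sum, sum_sub_distrib, sum_div, hXsum, mul_sum]
        congr 2
        exact sum_congr rfl fun K _ => by ring
    _ ≤ _ := by
        rw [hM]
        exact sum_le_sum fun K _ => hterm K

lemma Fair.matchBound_mul_le {P : EMLoadProcess V} {F : ℝ} (hfair : P.Fair F)
    (hF : 0 ≤ F) {t : ℕ} {E : Set P.Ω}
    (hE : MeasurableSet[P.hist (t + 1)] E) {u v : V} (huv : u ≠ v) :
    P.matchBound F * P.μ.real E ≤ P.μ.real (E ∩ {ω | s(u, v) ∈ P.M (t + 1) ω}) := by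
  classical
  have hsum := fun E' => measureReal_inter_eq_sum P.μ (P.measurable_G t) E' (fun _ => True)
  simp only [Set.ofPred_true, Set.inter_univ, if_true] at hsum
  rw [hsum E, hsum (E ∩ _), mul_sum]
  refine sum_le_sum fun H _ => ?_
  have hEH : MeasurableSet[P.hist (t + 1)] (E ∩ {ω | P.G t ω = H}) :=
    hE.inter (P.meas_G t (show MeasurableSet[⊤] {H} from trivial))
  rw [Set.inter_right_comm]
  exact hfair.matchBound_mul_le_of_subset hF hEH Set.inter_subset_right huv

open scoped ENNReal in
lemma Fair.matchBound_mul_lintegral_le {P : EMLoadProcess V} {F : ℝ} (hfair : P.Fair F)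
    (hF : 0 ≤ F) {t : ℕ} {f : P.Ω → ℝ≥0∞} (hf : Measurable[P.hist (t + 1)] f) {u v : V}
    (huv : u ≠ v) :
    ENNReal.ofReal (P.matchBound F) * ∫⁻ ω, f ω ∂P.μ
      ≤ ∫⁻ ω in {ω | s(u, v) ∈ P.M (t + 1) ω}, f ω ∂P.μ := by
  have hle := P.hist_le (t + 1)
  rw [← lintegral_trim hle hf, ← lintegral_trim hle hf, ← smul_eq_mul, ← lintegral_smul_measure]
  refine lintegral_mono' (Measure.le_iff.2 fun s hs => ?_) le_rfl
  rw [Measure.smul_apply, trim_measurableSet_eq hle hs, trim_measurableSet_eq hle hs,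
    Measure.restrict_apply (hle _ hs), smul_eq_mul, ← ofReal_measureReal, ← ofReal_measureReal,
    ← ENNReal.ofReal_mul' measureReal_nonneg]
  exact ENNReal.ofReal_le_ofReal (hfair.matchBound_mul_le hF hs huv)

/-- The loads at time `t`, centred at `m`. -/
def centred (m : ℤ) (t : ℕ) (ω : P.Ω) (v : V) : ℤ := P.Γ t ω v - m

lemma balanceStep (m : ℤ) (t : ℕ) (ω : P.Ω) :
    BalanceStep (P.M t ω) (P.centred m t ω) (P.centred m (t + 1) ω) where
  matching := P.M_matching t ω
  unmatched v hv := by simp [centred, P.unmatched t ω v hv]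
  matched v u h := by
    have := P.matched t ω v u h
    simp only [centred]
    omega

lemma measurable_comp_centred {β : Type*} [MeasurableSpace β] (f : (V → ℤ) → β) (m : ℤ) (t : ℕ) :
    Measurable[P.hist t] fun ω => f (P.centred m t ω) := fun s _ =>
  P.meas_Γ t (show MeasurableSet[⊤]
    ((fun γ : V → ℕ => f (fun v => (γ v : ℤ) - m)) ⁻¹' s) from trivial)

lemma sum_centred (m : ℤ) (t : ℕ) (ω : P.Ω) :
    ∑ v, P.centred m t ω v = ∑ v, P.centred m 0 ω v := by
  induction t with
  | zero => rfl
  | succ t ih => rw [(P.balanceStep m t ω).sum_eq, ih]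

open scoped ENNReal in
/-- The expected potential at time `t`. -/
def expPotential (m : ℤ) (t : ℕ) : ℝ≥0∞ :=
  ∫⁻ ω, ((potential (P.centred m t ω)).toNat : ℝ≥0∞) ∂P.μ

lemma expPotential_succ_le (m : ℤ) (t : ℕ) : P.expPotential m (t + 1) ≤ P.expPotential m t :=
  lintegral_mono fun ω => Nat.cast_le.2 (Int.toNat_le_toNat (P.balanceStep m t ω).potential_le)

open Classical in
open scoped ENNReal in
lemma Fair.expPotential_add_le {P : EMLoadProcess V} {F : ℝ} (hfair : P.Fair F)
    (hF : 0 ≤ F) {m : ℤ} (hm : ∀ ω, 2 * |∑ v, P.centred m 0 ω v| ≤ Fintype.card V) (t : ℕ) :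
    16 * P.expPotential m (t + 2) + ENNReal.ofReal (P.matchBound F) *
      (Fintype.card V * P.expPotential m (t + 1)) ≤ 16 * P.expPotential m (t + 1) := by
  let W : ℕ → P.Ω → ℝ≥0∞ := fun t ω => ((potential (P.centred m t ω)).toNat : ℝ≥0∞)
  let d : V → V → P.Ω → ℝ≥0∞ := fun u v ω =>
    ((potentialDrop (P.centred m (t + 1) ω) u v).toNat : ℝ≥0∞)
  have hW : ∀ t, Measurable (W t) := fun t =>
    (P.measurable_comp_centred (fun z => ((potential z).toNat : ℝ≥0∞)) m t).mono
      (P.hist_le t) le_rfl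
  have hd : ∀ u v, Measurable[P.hist (t + 1)] (d u v) := fun u v =>
    P.measurable_comp_centred (fun z => ((potentialDrop z u v).toNat : ℝ≥0∞)) m (t + 1)
  have hd' : ∀ u v, Measurable (d u v) := fun u v => (hd u v).mono (P.hist_le _) le_rfl
  let B : V → V → Set P.Ω := fun u v => {ω | s(u, v) ∈ P.M (t + 1) ω}
  have hB : ∀ u v, MeasurableSet (B u v) := fun u v =>
    P.measurable_M (t + 1) (show MeasurableSet[⊤] {N | s(u, v) ∈ N} from trivial)
  have hpath : ∀ ω, 16 * W (t + 2) ω + 8 * ∑ u, ∑ v, (B u v).indicator (d u v) ω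
      ≤ 16 * W (t + 1) ω := by
    intro ω
    have h1 := (P.balanceStep m (t + 1) ω).potential_add_le
    have h2 : 16 * (potential (P.centred m (t + 2) ω)).toNat + 8 * ∑ u, ∑ v,
        (if s(u, v) ∈ P.M (t + 1) ω then
          (potentialDrop (P.centred m (t + 1) ω) u v).toNat else 0)
        ≤ 16 * (potential (P.centred m (t + 1) ω)).toNat := by
      zify
      simp only [potential_nonneg, potentialDrop_nonneg, Int.ofNat_toNat, max_eq_left]
      linarith
    have h3 : ((16 * (potential (P.centred m (t + 2) ω)).toNat + 8 * ∑ u, ∑ v,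
        (if s(u, v) ∈ P.M (t + 1) ω then
          (potentialDrop (P.centred m (t + 1) ω) u v).toNat else 0) : ℕ) : ℝ≥0∞)
        ≤ ((16 * (potential (P.centred m (t + 1) ω)).toNat : ℕ) : ℝ≥0∞) := Nat.cast_le.2 h2
    push_cast at h3
    simpa [W, d, B, Set.indicator_apply] using h3
  have hdrop : ∀ ω, Fintype.card V * W (t + 1) ω ≤ 8 * ∑ u, ∑ v, d u v ω := by
    intro ω
    have h1 := card_mul_potential_le (P.centred m (t + 1) ω)
      (by rw [P.sum_centred]; exact hm ω)
    have h2 : Fintype.card V * (potential (P.centred m (t + 1) ω)).toNat ≤ 8 * ∑ u, ∑ v,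
          (potentialDrop (P.centred m (t + 1) ω) u v).toNat := by
      zify
      simpa only [potential_nonneg, potentialDrop_nonneg, Int.ofNat_toNat, max_eq_left] using h1
    have h3 := (Nat.cast_le (α := ℝ≥0∞)).2 h2
    push_cast at h3
    exact h3
  have hint := lintegral_mono (μ := P.μ) hpath
  rw [lintegral_add_left ((hW _).const_mul _), lintegral_const_mul _ (hW _),
    lintegral_const_mul _ (hW _), lintegral_const_mul _ (by
      refine Finset.measurable_sum _ fun u _ => Finset.measurable_sum _ fun v _ => ?_
      exact (hd' u v).indicator (hB u v)), lintegral_finsetSum _ (fun u _ =>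
      Finset.measurable_sum _ fun v _ => (hd' u v).indicator (hB u v))] at hint
  refine le_trans (add_le_add le_rfl ?_) hint
  calc ENNReal.ofReal (P.matchBound F) * (Fintype.card V * P.expPotential m (t + 1))
      ≤ ENNReal.ofReal (P.matchBound F) * (8 * ∑ u, ∑ v, ∫⁻ ω, d u v ω ∂P.μ) := by
        refine mul_le_mul' le_rfl ?_
        rw [expPotential, ← lintegral_const_mul _ (hW _)]
        refine (lintegral_mono hdrop).trans (le_of_eq ?_)
        rw [lintegral_const_mul _ (Finset.measurable_sum _ fun u _ =>
          Finset.measurable_sum _ fun v _ => hd' u v),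
          lintegral_finsetSum _ (fun u _ => Finset.measurable_sum _ fun v _ => hd' u v)]
        congr 1
        exact sum_congr rfl fun u _ => lintegral_finsetSum _ fun v _ => hd' u v
    _ = 8 * ∑ u, ∑ v, ENNReal.ofReal (P.matchBound F) * ∫⁻ ω, d u v ω ∂P.μ := by
        simp only [mul_sum]
        refine sum_congr rfl fun u _ => sum_congr rfl fun v _ => ?_
        ring
    _ ≤ _ := by
        gcongr with u _
        rw [lintegral_finsetSum _ fun v _ => (hd' u v).indicator (hB u v)]
        gcongr with v _
        rw [lintegral_indicator (hB u v)]
        by_cases huv : u = v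
        · subst huv
          simp [d, potentialDrop_self]
        · exact hfair.matchBound_mul_lintegral_le hF (hd u v) huv

lemma expPotential_zero_le {Γ₀ : V → ℕ} (h0 : ∀ ω, P.Γ 0 ω = Γ₀) {m : ℤ} {D : ℕ}
    (hD : ∀ v, |(Γ₀ v : ℤ) - m| ≤ D) :
    P.expPotential m 0 ≤ ((2 * Fintype.card V * D ^ 2 : ℕ) : ENNReal) := by
  have hpt : ∀ ω, (potential (P.centred m 0 ω)).toNat ≤ 2 * Fintype.card V * D ^ 2 := by
    intro ω
    have h1 := potential_le (P.centred m 0 ω)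
    have h2 : ∑ v, P.centred m 0 ω v ^ 2 ≤ ∑ _v : V, (D : ℤ) ^ 2 := by
      refine sum_le_sum fun v _ => ?_
      rw [centred, h0]
      exact sq_le_sq' (abs_le.1 (hD v)).1 (abs_le.1 (hD v)).2
    rw [sum_const, card_univ, nsmul_eq_mul] at h2
    zify
    rw [Int.toNat_of_nonneg (potential_nonneg _)]
    linarith
  refine (lintegral_mono fun ω => Nat.cast_le.2 (hpt ω)).trans ?_
  rw [lintegral_const, measure_univ, mul_one]

lemma expPotential_ne_top {Γ₀ : V → ℕ} (h0 : ∀ ω, P.Γ 0 ω = Γ₀) {m : ℤ} {D : ℕ}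
    (hD : ∀ v, |(Γ₀ v : ℤ) - m| ≤ D) (t : ℕ) : P.expPotential m t ≠ ⊤ := by
  induction t with
  | zero => exact ne_top_of_le_ne_top (ENNReal.natCast_ne_top _) (P.expPotential_zero_le h0 hD)
  | succ t ih => exact ne_top_of_le_ne_top ih (P.expPotential_succ_le m t)

lemma measure_unbalanced_le (m : ℤ) (t : ℕ) :
    P.μ {ω | ∃ v, 1 < |(P.Γ t ω v : ℤ) - m|} ≤ P.expPotential m t := by
  have hm : Measurable fun ω => ((potential (P.centred m t ω)).toNat : ENNReal) :=
    (P.measurable_comp_centred (fun z => ((potential z).toNat : ENNReal)) m t).mono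
      (P.hist_le t) le_rfl
  have h := mul_meas_ge_le_lintegral (μ := P.μ) hm 1
  rw [one_mul] at h
  refine (measure_mono ?_).trans h
  rintro ω ⟨v, hv⟩
  have : 1 ≤ potential (P.centred m t ω) := one_le_potential (v := v) hv
  exact_mod_cast (show 1 ≤ (potential (P.centred m t ω)).toNat by omega)

lemma r_mul_minProb : P.r * P.minProb = P.maxProb := by
  have hp := P.p_pos
  have hq : 0 < 1 - P.q := by linarith [P.q_lt_one]
  unfold r minProb maxProb
  rcases le_total P.p (1 - P.q) with h | h
  · rw [min_eq_left h, max_eq_right h, max_eq_right, div_mul_cancel₀ _ hp.ne']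
    rw [div_le_div_iff₀ hq hp]
    nlinarith
  · rw [min_eq_right h, max_eq_left h, max_eq_left, div_mul_cancel₀ _ hq.ne']
    rw [div_le_div_iff₀ hp hq]
    nlinarith

lemma one_le_r : 1 ≤ P.r := by
  have h : P.minProb ≤ P.maxProb := min_le_max
  rw [← P.r_mul_minProb] at h
  exact (le_mul_iff_one_le_left P.minProb_pos).1 h

lemma le_card_mul_matchBound [Nonempty V] {θ F : ℝ} (hF : 0 ≤ F)
    (h : θ / (Fintype.card V : ℝ) ≤ max P.p (1 - P.q)) (hθ : 0 < θ) :
    F / P.r * (θ / (1 + 2 * θ)) ≤ Fintype.card V * P.matchBound F := by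
  have hn : (0 : ℝ) < Fintype.card V := by exact_mod_cast Fintype.card_pos
  have hb := P.maxProb_pos
  have hr : 0 < P.r := one_pos.trans_le P.one_le_r
  rw [matchBound]
  set n : ℝ := (Fintype.card V : ℝ)
  have hx : θ ≤ n * P.maxProb := by
    rw [div_le_iff₀ hn] at h
    rw [mul_comm]
    exact h
  have h1 : n * (F * P.minProb / (1 + 2 * n * P.maxProb))
      = F / P.r * (n * P.maxProb / (1 + 2 * (n * P.maxProb))) := by
    rw [← P.r_mul_minProb, ← mul_assoc 2 n]
    field_simp
  rw [h1]
  refine mul_le_mul_of_nonneg_left ?_ (by positivity)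
  rw [div_le_div_iff₀ (by positivity) (by positivity)]
  linarith

lemma Fair.toReal_expPotential_le [Nonempty V] {P : EMLoadProcess V} {F : ℝ} (hfair : P.Fair F)
    (hF : 0 ≤ F) {Γ₀ : V → ℕ} (h0 : ∀ ω, P.Γ 0 ω = Γ₀) {m : ℤ} {D : ℕ}
    (hD : ∀ v, |(Γ₀ v : ℤ) - m| ≤ D) (hm : 2 * |∑ v, ((Γ₀ v : ℤ) - m)| ≤ Fintype.card V)
    {δ : ℝ} (hδ : δ ≤ Fintype.card V * P.matchBound F / 16) (t : ℕ) :
    (P.expPotential m (t + 1)).toReal ≤ Real.exp (-δ * t) * (2 * Fintype.card V * D ^ 2) := by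
  have hfin := P.expPotential_ne_top h0 hD
  have hπ : 0 ≤ P.matchBound F :=
    div_nonneg (mul_nonneg hF P.minProb_pos.le) (by have := P.maxProb_pos; positivity)
  induction t with
  | zero =>
    have h := ENNReal.toReal_mono (ENNReal.natCast_ne_top _)
      ((P.expPotential_succ_le m 0).trans (P.expPotential_zero_le h0 hD))
    rw [ENNReal.toReal_natCast] at h
    simpa using h
  | succ t ih =>
    have h := hfair.expPotential_add_le hF (m := m)
      (fun ω => by simpa only [centred, h0] using hm) t
    have h2 := ENNReal.toReal_mono (ENNReal.mul_ne_top (by simp) (hfin (t + 1))) h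
    have hcard : ((Fintype.card V : ENNReal)) ≠ ⊤ := ENNReal.natCast_ne_top _
    rw [ENNReal.toReal_add (ENNReal.mul_ne_top (by simp) (hfin _))
      (ENNReal.mul_ne_top ENNReal.ofReal_ne_top (ENNReal.mul_ne_top hcard (hfin _)))] at h2
    simp only [ENNReal.toReal_mul, ENNReal.toReal_ofReal hπ, ENNReal.toReal_natCast,
      ENNReal.toReal_ofNat] at h2
    have hb : 0 ≤ (P.expPotential m (t + 1)).toReal := ENNReal.toReal_nonneg
    have hexp : 1 - δ ≤ Real.exp (-δ) := by linarith [Real.add_one_le_exp (-δ)]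
    calc (P.expPotential m (t + 1 + 1)).toReal
        ≤ (1 - Fintype.card V * P.matchBound F / 16) * (P.expPotential m (t + 1)).toReal := by
          linarith
      _ ≤ Real.exp (-δ) * (P.expPotential m (t + 1)).toReal := by
          gcongr
          linarith
      _ ≤ Real.exp (-δ) * (Real.exp (-δ * t) * (2 * Fintype.card V * D ^ 2)) := by gcongr
      _ = _ := by
          rw [← mul_assoc, ← Real.exp_add]
          congr 2
          push_cast
          ring

end EMLoadProcess

lemma two_mul_abs_sum_sub_roundNear_le {V : Type} [Fintype V] [Nonempty V] (Γ₀ : V → ℕ) :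
    2 * |∑ v, ((Γ₀ v : ℤ) - roundNear (avgLoad Γ₀))| ≤ Fintype.card V := by
  have hn : (0 : ℝ) < Fintype.card V := by exact_mod_cast Fintype.card_pos
  have h1 : avgLoad Γ₀ - 1 / 2 ≤ roundNear (avgLoad Γ₀) := Int.le_ceil _
  have h2 : roundNear (avgLoad Γ₀) < avgLoad Γ₀ - 1 / 2 + 1 := Int.ceil_lt_add_one _
  have h3 : avgLoad Γ₀ * Fintype.card V = ∑ v, (Γ₀ v : ℝ) := div_mul_cancel₀ _ hn.ne'
  set m := roundNear (avgLoad Γ₀)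
  have h4 : ((∑ v, ((Γ₀ v : ℤ) - m) : ℤ) : ℝ) = (avgLoad Γ₀ - m) * Fintype.card V := by
    rw [sub_mul, h3]
    push_cast
    rw [sum_sub_distrib, sum_const, card_univ, nsmul_eq_mul]
    ring
  have h5 : 2 * |((∑ v, ((Γ₀ v : ℤ) - m) : ℤ) : ℝ)| ≤ Fintype.card V := by
    rw [h4, abs_mul, abs_of_pos hn]
    have : |avgLoad Γ₀ - m| ≤ 1 / 2 := abs_le.2 ⟨by linarith, by linarith⟩
    nlinarith
  exact_mod_cast h5

lemma abs_sub_roundNear_le_disc {V : Type} [Fintype V] [Nonempty V] (Γ₀ : V → ℕ) (v : V) :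
    |(Γ₀ v : ℤ) - roundNear (avgLoad Γ₀)| ≤ disc Γ₀ := by
  have hn : (0 : ℝ) < Fintype.card V := by exact_mod_cast Fintype.card_pos
  unfold disc
  set hi := univ.sup Γ₀
  set lo := univ.inf' univ_nonempty Γ₀
  have h1 : ∀ v, Γ₀ v ≤ hi := fun v => le_sup (mem_univ v)
  have h2 : ∀ v, lo ≤ Γ₀ v := fun v => inf'_le _ (mem_univ v)
  have h3 : avgLoad Γ₀ ≤ hi := by
    rw [avgLoad, div_le_iff₀ hn]
    calc ∑ v, (Γ₀ v : ℝ) ≤ ∑ _v : V, (hi : ℝ) := sum_le_sum fun v _ => by exact_mod_cast h1 v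
      _ = _ := by rw [sum_const, card_univ, nsmul_eq_mul, mul_comm]
  have h4 : lo ≤ avgLoad Γ₀ := by
    rw [avgLoad, le_div_iff₀ hn]
    calc (lo : ℝ) * Fintype.card V = ∑ _v : V, (lo : ℝ) := by
          rw [sum_const, card_univ, nsmul_eq_mul, mul_comm]
      _ ≤ _ := sum_le_sum fun v _ => by exact_mod_cast h2 v
  have h5 : roundNear (avgLoad Γ₀) ≤ hi := Int.ceil_le.2 (by push_cast; linarith)
  have h6 : (lo : ℤ) - 1 < roundNear (avgLoad Γ₀) := Int.lt_ceil.2 (by push_cast; linarith)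
  have h7 := h1 v
  have h8 := h2 v
  rw [abs_le]
  omega

lemma exp_decay_le {n D ε δ s : ℝ} (hn : 1 ≤ n) (hD : 1 ≤ D) (hε : 0 < ε) (hε' : ε < 1 / 4)
    (hs : 2 * Real.log (D * n / ε) ≤ δ * s) :
    Real.exp (-δ * s) * (2 * n * D ^ 2) ≤ ε := by
  have hx : 0 < D * n / ε := by positivity
  have h1 : Real.exp (-δ * s) ≤ (ε / (D * n)) ^ 2 := by
    calc Real.exp (-δ * s) ≤ Real.exp (-(2 * Real.log (D * n / ε))) :=
          Real.exp_le_exp.2 (by linarith)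
      _ = (ε / (D * n)) ^ 2 := by
          rw [Real.exp_neg, two_mul, Real.exp_add, Real.exp_log hx, ← sq, ← inv_pow, inv_div]
  calc _ ≤ (ε / (D * n)) ^ 2 * (2 * n * D ^ 2) := by gcongr
    _ = 2 * ε ^ 2 / n := by field_simp
    _ ≤ 2 * ε ^ 2 / 1 := by gcongr
    _ ≤ ε := by nlinarith

end Execution

/-- **Balancing time of random matching algorithms on edge-Markovian evolving graphs.**
Suppose `p ∈ (0,1]` and `q ∈ [0,1)` satisfy `max{p, 1−q} ≥ θ/n` for a constant `θ > 0`, and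
consider a random matching algorithm on an edge-Markovian evolving graph with parameters
`p, q` whose matching distributions satisfy the `F`-fair condition for some `0 < F ≤ 1`.
Then there is a constant `c > 0` depending only on `θ` such that for any initial
configuration `Γ₀` and any `0 < ε < 1/4`, with probability at least `1 − ε` the balancing
time satisfies `T_bal ≤ (c·r/F)·log(Δ·n/ε)`; i.e. with probability at least `1 − ε` there is
a time `t ≤ (c·r/F)·log(Δ·n/ε)` at which every load lies in `{⌈μ⌋−1, ⌈μ⌋, ⌈μ⌋+1}`. -/
theorem random_matching_balancing_time (θ : ℝ) (hθ : 0 < θ) :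
    ∃ c : ℝ, 0 < c ∧
      ∀ (V : Type) [Fintype V] [DecidableEq V] [Nonempty V],
        ∀ (P : EMLoadProcess V) (F : ℝ) (Γ₀ : V → ℕ) (ε : ℝ),
          0 < F → F ≤ 1 → P.Fair F →
          θ / (Fintype.card V : ℝ) ≤ max P.p (1 - P.q) →
          (∀ ω, P.Γ 0 ω = Γ₀) →
          0 < ε → ε < 1 / 4 →
          ENNReal.ofReal (1 - ε) ≤
            P.μ {ω | ∃ t : ℕ,
              (t : ℝ) ≤ c * P.r / F * Real.log ((disc Γ₀ : ℝ) * (Fintype.card V : ℝ) / ε) ∧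
              ∀ v : V, |(P.Γ t ω v : ℤ) - roundNear (avgLoad Γ₀)| ≤ 1} := by
  set κ : ℝ := θ / (1 + 2 * θ) / 16 with hκ
  have hκ0 : 0 < κ := by positivity
  refine ⟨2 / κ + 2, by positivity, ?_⟩
  intro V _ _ _ P F Γ₀ ε hF hF1 hfair hpq h0 hε hε'
  let _ := P.mΩ
  have := P.isProb
  have hdisc := abs_sub_roundNear_le_disc Γ₀
  rcases Nat.eq_zero_or_pos (disc Γ₀) with hD0 | hD0
  · have huniv : {ω | ∃ t : ℕ, (t : ℝ) ≤ (2 / κ + 2) * P.r / F *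
        Real.log ((disc Γ₀ : ℝ) * (Fintype.card V : ℝ) / ε) ∧
        ∀ v : V, |(P.Γ t ω v : ℤ) - roundNear (avgLoad Γ₀)| ≤ 1} = Set.univ := by
      refine Set.eq_univ_of_forall fun ω => ⟨0, by simp [hD0], fun v => ?_⟩
      rw [h0]
      refine (hdisc v).trans ?_
      simp [hD0]
    rw [huniv, MeasureTheory.measure_univ]
    exact ENNReal.ofReal_le_one.2 (by linarith)
  set m := roundNear (avgLoad Γ₀) with hm
  set L := Real.log ((disc Γ₀ : ℝ) * (Fintype.card V : ℝ) / ε) with hL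
  have hr := P.one_le_r
  have hn : (1 : ℝ) ≤ Fintype.card V := by exact_mod_cast Fintype.card_pos
  have hD : (1 : ℝ) ≤ disc Γ₀ := by exact_mod_cast hD0
  have hL1 : 1 ≤ L := by
    rw [hL, Real.le_log_iff_exp_le (by positivity), le_div_iff₀ hε]
    have := Real.exp_one_lt_d9
    nlinarith
  set δ : ℝ := F / P.r * κ with hδ
  have hδ0 : 0 < δ := by positivity
  have hδle : δ ≤ Fintype.card V * P.matchBound F / 16 := by
    have := P.le_card_mul_matchBound hF.le hpq hθ
    rw [hδ, hκ]
    linarith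
  set s : ℕ := ⌈2 * L / δ⌉₊ with hs
  have hs1 : 2 * L ≤ δ * s := by
    have := Nat.le_ceil (2 * L / δ)
    rw [div_le_iff₀ hδ0] at this
    linarith
  have hs2 : ((s + 1 : ℕ) : ℝ) ≤ (2 / κ + 2) * P.r / F * L := by
    have h1 : (s : ℝ) < 2 * L / δ + 1 := Nat.ceil_lt_add_one (by positivity)
    have h2 : 2 * L / δ = 2 / κ * (P.r / F) * L := by
      rw [hδ]
      field_simp
    have h3 : 1 ≤ P.r / F * L := by
      have : 1 ≤ P.r / F := by rw [le_div_iff₀ hF]; linarith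
      nlinarith
    have h4 : (2 / κ + 2) * P.r / F * L = 2 / κ * (P.r / F) * L + 2 * (P.r / F * L) := by ring
    push_cast
    linarith
  have hbad : P.μ {ω | ∃ v, 1 < |(P.Γ (s + 1) ω v : ℤ) - m|} ≤ ENNReal.ofReal ε := by
    refine (P.measure_unbalanced_le m (s + 1)).trans ?_
    rw [← ENNReal.ofReal_toReal (P.expPotential_ne_top h0 hdisc (s + 1))]
    refine ENNReal.ofReal_le_ofReal ?_
    exact (hfair.toReal_expPotential_le hF.le h0 hdisc (two_mul_abs_sum_sub_roundNear_le Γ₀)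
      hδle s).trans (exp_decay_le hn hD hε hε' hs1)
  have hmeas : MeasurableSet {ω | ∃ v, 1 < |(P.Γ (s + 1) ω v : ℤ) - m|} :=
    P.measurable_Γ (s + 1) (show @MeasurableSet _ ⊤ {γ : V → ℕ | ∃ v, 1 < |(γ v : ℤ) - m|} from
      trivial)
  calc ENNReal.ofReal (1 - ε) = 1 - ENNReal.ofReal ε := by
        rw [ENNReal.ofReal_sub _ hε.le, ENNReal.ofReal_one]
    _ ≤ 1 - P.μ {ω | ∃ v, 1 < |(P.Γ (s + 1) ω v : ℤ) - m|} := tsub_le_tsub_left hbad 1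
    _ = P.μ {ω | ∃ v, 1 < |(P.Γ (s + 1) ω v : ℤ) - m|}ᶜ :=
        (MeasureTheory.prob_compl_eq_one_sub hmeas).symm
    _ ≤ _ := by
        refine MeasureTheory.measure_mono fun ω hω => ?_
        exact ⟨s + 1, hs2, fun v => not_lt.1 fun h => hω ⟨v, h⟩⟩

end
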